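/- arXiv:2211.13427 — 2 statements merged into one kernel-verified Lean document; each statement's English description precedes it below -/
import Mathlib

section
/- Let w ∈ W. A function ν : ℝ^N → ℝ satisfies ν = ν_w (i.e., ν is the order-based fairness measure with weight vector w) if and only if ν satisfies all of: (1) normalization: ν(u) ≥ 0 for all u, with ν(u) = 0 iff u = α·1 for some α ∈ ℝ; (2) Schur convexity: u¹ majorized by u² implies ν(u¹) ≤ ν(u²); (3) positive homogeneity: ν(αu) = αν(u) for all α > 0; (4) proportional adjustment with constants (w_1,…,w_N): for every u ∈ ℝ^N with u_1 ≤ … ≤ u_N, every j ∈ {1,…,N} and every ε with 0 ≤ ε ≤ u_{j+1} − u_j (ε ≥ 0 unrestricted when j = N), ν(u + ε e_j) = ν(u) + ε w_j, where e_j is the j-th standard basis vector. -/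
/-- The nondecreasing rearrangement of `u`: `sortedVec u i` is the `i`-th smallest entry. -/
noncomputable def sortedVec {N : ℕ} (u : Fin N → ℝ) : Fin N → ℝ :=
  u ∘ Tuple.sort u

/-- The order-based functional `ν_w(u) = Σ_i w_i u_(i)`. -/
noncomputable def nuw {N : ℕ} (w u : Fin N → ℝ) : ℝ :=
  ∑ i, w i * sortedVec u i

/-- `x` is majorized by `y`. -/
def MajorizedBy {N : ℕ} (x y : Fin N → ℝ) : Prop :=
  (∑ i, x i) = (∑ i, y i) ∧
  ∀ k : ℕ, 2 ≤ k → k ≤ N →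
    (∑ i ∈ Finset.univ.filter (fun i : Fin N => k ≤ (i : ℕ) + 1), sortedVec x i) ≤
      ∑ i ∈ Finset.univ.filter (fun i : Fin N => k ≤ (i : ℕ) + 1), sortedVec y i

theorem monotone_sortedVec {N : ℕ} (u : Fin N → ℝ) : Monotone (sortedVec u) :=
  Tuple.monotone_sort u

theorem sortedVec_eq_comp {N : ℕ} {u : Fin N → ℝ} {σ : Equiv.Perm (Fin N)}
    (h : Monotone (u ∘ σ)) : sortedVec u = u ∘ σ :=
  Tuple.unique_monotone (Tuple.monotone_sort u) h

theorem sortedVec_of_monotone {N : ℕ} {u : Fin N → ℝ} (h : Monotone u) : sortedVec u = u :=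
  sortedVec_eq_comp (σ := Equiv.refl _) h

theorem sortedVec_smul {N : ℕ} {α : ℝ} (hα : 0 ≤ α) (u : Fin N → ℝ) :
    sortedVec (α • u) = α • sortedVec u :=
  sortedVec_eq_comp (σ := Tuple.sort u) fun _ _ hij =>
    mul_le_mul_of_nonneg_left (monotone_sortedVec u hij) hα

theorem sum_sortedVec {N : ℕ} (u : Fin N → ℝ) : ∑ i, sortedVec u i = ∑ i, u i :=
  Equiv.sum_comp (Tuple.sort u) u

theorem majorizedBy_of_sortedVec_eq {N : ℕ} {x y : Fin N → ℝ} (h : sortedVec x = sortedVec y) :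
    MajorizedBy x y :=
  ⟨by rw [← sum_sortedVec x, h, sum_sortedVec], fun _ _ _ => by rw [h]⟩

theorem sum_tail_eq_add {N : ℕ} (f : Fin N → ℝ) (k : Fin N) :
    ∑ i ∈ Finset.univ.filter (fun i : Fin N => (k : ℕ) ≤ i), f i =
      f k + ∑ i ∈ Finset.univ.filter (fun i : Fin N => (k : ℕ) + 1 ≤ i), f i := by
  rw [← Finset.sum_insert (by simp)]
  congr 1
  ext i
  simp only [Finset.mem_filter, Finset.mem_univ, true_and, Finset.mem_insert, Fin.ext_iff]
  omega

theorem sum_tail_of_le {N : ℕ} (f : Fin N → ℝ) {k : ℕ} (hk : N ≤ k) :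
    ∑ i ∈ Finset.univ.filter (fun i : Fin N => k ≤ i), f i = 0 := by
  rw [Finset.filter_false_of_mem (fun i _ => by omega), Finset.sum_empty]

/-- Abel summation: a monotone weight against a vector with nonnegative tail sums. -/
theorem mul_sum_tail_le {N : ℕ} {w d : Fin N → ℝ} (hw : Monotone w)
    (hd : ∀ k : ℕ, 1 ≤ k → k < N →
      0 ≤ ∑ i ∈ Finset.univ.filter (fun i : Fin N => k ≤ i), d i) (k : Fin N) :
    w k * ∑ i ∈ Finset.univ.filter (fun i : Fin N => (k : ℕ) ≤ i), d i ≤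
      ∑ i ∈ Finset.univ.filter (fun i : Fin N => (k : ℕ) ≤ i), w i * d i := by
  obtain ⟨m, hm⟩ : ∃ m, m + (k : ℕ) + 1 = N := ⟨N - k - 1, by omega⟩
  induction m generalizing k with
  | zero =>
    rw [sum_tail_eq_add d, sum_tail_eq_add (fun i => w i * d i),
      sum_tail_of_le d (by omega), sum_tail_of_le (fun i => w i * d i) (by omega)]
    simp
  | succ m ih =>
    have hk : (k : ℕ) + 1 < N := by omega
    have h1 := ih ⟨k + 1, hk⟩ (by simp only; omega)
    have h2 := mul_le_mul_of_nonneg_right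
      (hw (show k ≤ ⟨k + 1, hk⟩ from Fin.le_def.2 (Nat.le_succ _))) (hd (k + 1) (by omega) hk)
    rw [sum_tail_eq_add d, sum_tail_eq_add (fun i => w i * d i), mul_add]
    simp only at h1
    linarith

theorem sum_mul_nonneg_of_sum_tail_nonneg {N : ℕ} {w d : Fin N → ℝ} (hw : Monotone w)
    (hsum : ∑ i, d i = 0)
    (hd : ∀ k : ℕ, 1 ≤ k → k < N →
      0 ≤ ∑ i ∈ Finset.univ.filter (fun i : Fin N => k ≤ i), d i) :
    0 ≤ ∑ i, w i * d i := by
  rcases Nat.eq_zero_or_pos N with rfl | hN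
  · simp
  · simpa [hsum] using mul_sum_tail_le hw hd ⟨0, hN⟩

theorem nuw_le_nuw_of_majorizedBy {N : ℕ} {w x y : Fin N → ℝ} (hw : Monotone w)
    (h : MajorizedBy x y) : nuw w x ≤ nuw w y := by
  have key := sum_mul_nonneg_of_sum_tail_nonneg (d := sortedVec y - sortedVec x) hw
    (by simp [Finset.sum_sub_distrib, sum_sortedVec, h.1])
    (fun k hk hkN => by
      have := h.2 (k + 1) (by omega) (by omega)
      simp only [add_le_add_iff_right] at this
      simpa [Finset.sum_sub_distrib] using this)
  simp only [Pi.sub_apply, mul_sub, Finset.sum_sub_distrib] at key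
  exact sub_nonneg.1 key

theorem sum_mul_eq_sum_mul_sub {N : ℕ} {w : Fin N → ℝ} (hsum : ∑ i, w i = 0) (s : Fin N → ℝ)
    (c : ℝ) : ∑ i, w i * s i = ∑ i, w i * (s i - c) := by
  simp [mul_sub, Finset.sum_sub_distrib, ← Finset.sum_mul, hsum]

/-- Centering at the last entry with nonpositive weight makes all the terms of `nuw` nonnegative. -/
theorem exists_forall_mul_sub_nonneg {N : ℕ} {w s : Fin N → ℝ} (hw : Monotone w)
    (hs : Monotone s) (h : ∃ i, w i ≤ 0) : ∃ c, ∀ i, 0 ≤ w i * (s i - c) := by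
  obtain ⟨i₀, hi₀⟩ := h
  have hne : (Finset.univ.filter (fun i => w i ≤ 0)).Nonempty := ⟨i₀, by simpa using hi₀⟩
  obtain ⟨k, hk, hmax⟩ := Finset.exists_max_image _ id hne
  simp only [Finset.mem_filter, Finset.mem_univ, true_and, id] at hk hmax
  refine ⟨s k, fun i => ?_⟩
  rcases le_or_gt (w i) 0 with hi | hi
  · exact mul_nonneg_of_nonpos_of_nonpos hi (sub_nonpos.2 (hs (hmax i hi)))
  · refine mul_nonneg hi.le (sub_nonneg.2 (hs ?_))
    by_contra! hik
    exact absurd ((hw hik.le).trans hk) (not_le.2 hi)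

theorem nuw_nonneg {N : ℕ} {w : Fin N → ℝ} (hsum : ∑ i, w i = 0) (hw : Monotone w)
    (h : ∃ i, w i ≤ 0) (u : Fin N → ℝ) : 0 ≤ nuw w u := by
  obtain ⟨c, hc⟩ := exists_forall_mul_sub_nonneg hw (monotone_sortedVec u) h
  rw [nuw, sum_mul_eq_sum_mul_sub hsum _ c]
  exact Finset.sum_nonneg fun i _ => hc i

theorem nuw_const {N : ℕ} {w : Fin N → ℝ} (hsum : ∑ i, w i = 0) (α : ℝ) :
    nuw w (fun _ => α) = 0 := by
  rw [nuw, sortedVec_of_monotone monotone_const, ← Finset.sum_mul, hsum, zero_mul]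

theorem exists_eq_const_of_nuw_eq_zero {N : ℕ} (hN : 1 ≤ N) {w : Fin N → ℝ}
    (hsum : ∑ i, w i = 0) (hw : Monotone w) (hw1 : w ⟨0, hN⟩ < 0)
    (hwN : 0 < w ⟨N - 1, Nat.sub_lt hN Nat.one_pos⟩) {u : Fin N → ℝ} (hu : nuw w u = 0) :
    ∃ α : ℝ, u = fun _ => α := by
  obtain ⟨c, hc⟩ := exists_forall_mul_sub_nonneg hw (monotone_sortedVec u) ⟨_, hw1.le⟩
  rw [nuw, sum_mul_eq_sum_mul_sub hsum _ c, Finset.sum_eq_zero_iff_of_nonneg fun i _ => hc i] at hu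
  have h1 : sortedVec u ⟨0, hN⟩ = c := by
    simpa [hw1.ne, sub_eq_zero] using hu ⟨0, hN⟩ (Finset.mem_univ _)
  have h2 : sortedVec u ⟨N - 1, Nat.sub_lt hN Nat.one_pos⟩ = c := by
    simpa [hwN.ne', sub_eq_zero] using hu ⟨N - 1, Nat.sub_lt hN Nat.one_pos⟩ (Finset.mem_univ _)
  have h3 : ∀ i, sortedVec u i = c := fun i => le_antisymm
    (h2 ▸ monotone_sortedVec u (Fin.le_def.2 (by simp only; omega)))
    (h1 ▸ monotone_sortedVec u (Fin.le_def.2 (Nat.zero_le _)))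
  refine ⟨c, funext fun i => ?_⟩
  simpa [sortedVec] using h3 ((Tuple.sort u).symm i)

theorem nuw_smul {N : ℕ} (w : Fin N → ℝ) {α : ℝ} (hα : 0 ≤ α) (u : Fin N → ℝ) :
    nuw w (α • u) = α * nuw w u := by
  simp only [nuw, sortedVec_smul hα, Pi.smul_apply, smul_eq_mul, Finset.mul_sum]
  exact Finset.sum_congr rfl fun i _ => by ring

theorem monotone_update_add {N : ℕ} {u : Fin N → ℝ} (hu : Monotone u) (j : Fin N) {ε : ℝ}
    (hε : 0 ≤ ε) (h : ∀ h : (j : ℕ) + 1 < N, ε ≤ u ⟨(j : ℕ) + 1, h⟩ - u j) :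
    Monotone (Function.update u j (u j + ε)) := by
  intro a b hab
  by_cases ha : a = j <;> by_cases hb : b = j
  · rw [ha, hb]
  · subst ha
    rw [Function.update_self, Function.update_of_ne hb]
    have hlt : (a : ℕ) < b := Fin.lt_def.1 (lt_of_le_of_ne hab (Ne.symm hb))
    have h1 := h (by omega)
    have h2 := hu (show (⟨(a : ℕ) + 1, by omega⟩ : Fin N) ≤ b from Fin.le_def.2 hlt)
    linarith
  · subst hb
    rw [Function.update_self, Function.update_of_ne ha]
    linarith [hu hab]
  · rw [Function.update_of_ne ha, Function.update_of_ne hb]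
    exact hu hab

theorem nuw_update_add {N : ℕ} (w : Fin N → ℝ) {u : Fin N → ℝ} (hu : Monotone u) (j : Fin N)
    {ε : ℝ} (hε : 0 ≤ ε) (h : ∀ h : (j : ℕ) + 1 < N, ε ≤ u ⟨(j : ℕ) + 1, h⟩ - u j) :
    nuw w (Function.update u j (u j + ε)) = nuw w u + ε * w j := by
  rw [nuw, nuw, sortedVec_of_monotone (monotone_update_add hu j hε h), sortedVec_of_monotone hu]
  have : Function.update u j (u j + ε) = u + Pi.single j ε := by
    ext i
    rcases eq_or_ne i j with rfl | hi <;> simp [*]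
  simp only [this, Pi.add_apply, mul_add, Finset.sum_add_distrib]
  simp [Pi.single_apply, mul_comm]

/-- A functional that vanishes on constants and satisfies proportional adjustment is determined
on monotone vectors. -/
theorem eq_sum_of_monotone {N : ℕ} (hN : 1 ≤ N) {w : Fin N → ℝ} (hsum : ∑ i, w i = 0)
    {ν : (Fin N → ℝ) → ℝ} (hconst : ∀ α : ℝ, ν (fun _ => α) = 0)
    (hadj : ∀ u : Fin N → ℝ, Monotone u → ∀ j : Fin N, ∀ ε : ℝ, 0 ≤ ε →
      (∀ h : (j : ℕ) + 1 < N, ε ≤ u ⟨(j : ℕ) + 1, h⟩ - u j) →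
      ν (Function.update u j (u j + ε)) = ν u + ε * w j)
    {v : Fin N → ℝ} (hv : Monotone v) : ν v = ∑ i, w i * v i := by
  set c := v ⟨0, hN⟩
  have hcv : ∀ i, c ≤ v i := fun i => hv (Fin.le_def.2 (Nat.zero_le _))
  let g : ℕ → Fin N → ℝ := fun k i => if k ≤ (i : ℕ) then v i else c
  have hg : ∀ k, Monotone (g k) := fun k a b hab => by
    have := Fin.le_def.1 hab
    simp only [g]
    split_ifs
    · exact hv hab
    · omega
    · exact hcv b
    · rfl
  have key : ∀ m k, m + k = N →
      ν (g k) = ∑ i ∈ Finset.univ.filter (fun i : Fin N => k ≤ i), w i * (v i - c) := by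
    intro m
    induction m with
    | zero =>
      intro k hk
      have : g k = fun _ => c := funext fun i => if_neg (by omega)
      rw [this, hconst, sum_tail_of_le (fun i => w i * (v i - c)) (by omega)]
    | succ m ih =>
      intro k hk
      let j : Fin N := ⟨k, by omega⟩
      have hgj : g (k + 1) j = c := if_neg (by simp [j])
      have hstep : g k = Function.update (g (k + 1)) j (g (k + 1) j + (v j - c)) := by
        ext i
        rcases eq_or_ne i j with rfl | hi
        · rw [Function.update_self, hgj]
          simp [g, j]
        · rw [Function.update_of_ne hi]
          have : (i : ℕ) ≠ k := fun h => hi (Fin.ext h)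
          simp only [g]
          split_ifs <;> first | rfl | omega
      rw [hstep, hadj _ (hg _) j _ (sub_nonneg.2 (hcv j)), ih (k + 1) (by omega)]
      · have := sum_tail_eq_add (fun i => w i * (v i - c)) j
        simp only [j] at this ⊢
        rw [this]
        ring
      · intro h
        have h1 : g (k + 1) ⟨(j : ℕ) + 1, h⟩ = v ⟨(j : ℕ) + 1, h⟩ := if_pos (by simp [j])
        rw [h1, hgj]
        exact sub_le_sub_right (hv (Fin.le_def.2 (Nat.le_succ _))) _
  have h0 : g 0 = v := funext fun i => if_pos (Nat.zero_le _)
  rw [sum_mul_eq_sum_mul_sub hsum v c, ← h0, key N 0 (by omega), h0]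
  simp

/-- Axiomatic characterization of order-based fairness measures: for `w ∈ W`,
`ν = ν_w` iff `ν` satisfies normalization, Schur convexity, positive homogeneity,
and proportional adjustment with constants `(w_1,…,w_N)`. -/
theorem stmt5 {N : ℕ} (hN : 1 ≤ N) (w : Fin N → ℝ)
    (hsum : ∑ i, w i = 0) (hmono : Monotone w)
    (hw1 : w ⟨0, hN⟩ < 0) (hwN : 0 < w ⟨N - 1, Nat.sub_lt hN Nat.one_pos⟩)
    (ν : (Fin N → ℝ) → ℝ) :
    ν = nuw w ↔
      ((∀ u, 0 ≤ ν u) ∧ (∀ u, ν u = 0 ↔ ∃ α : ℝ, u = fun _ => α)) ∧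
      (∀ u₁ u₂ : Fin N → ℝ, MajorizedBy u₁ u₂ → ν u₁ ≤ ν u₂) ∧
      (∀ (α : ℝ) (u : Fin N → ℝ), 0 < α → ν (α • u) = α * ν u) ∧
      (∀ u : Fin N → ℝ, Monotone u → ∀ j : Fin N, ∀ ε : ℝ, 0 ≤ ε →
        (∀ h : (j : ℕ) + 1 < N, ε ≤ u ⟨(j : ℕ) + 1, h⟩ - u j) →
        ν (Function.update u j (u j + ε)) = ν u + ε * w j) := by
  constructor
  · rintro rfl
    exact ⟨⟨nuw_nonneg hsum hmono ⟨_, hw1.le⟩, fun u =>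
        ⟨exists_eq_const_of_nuw_eq_zero hN hsum hmono hw1 hwN, fun ⟨α, hα⟩ =>
          hα ▸ nuw_const hsum α⟩⟩,
      fun _ _ => nuw_le_nuw_of_majorizedBy hmono,
      fun _ u hα => nuw_smul w hα.le u,
      fun _ hu j _ hε h => nuw_update_add w hu j hε h⟩
  · rintro ⟨⟨-, hzero⟩, hschur, -, hadj⟩
    funext u
    have hs : sortedVec u = sortedVec (sortedVec u) :=
      (sortedVec_of_monotone (monotone_sortedVec u)).symm
    have hν : ν u = ν (sortedVec u) := le_antisymm
      (hschur _ _ (majorizedBy_of_sortedVec_eq hs))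
      (hschur _ _ (majorizedBy_of_sortedVec_eq hs.symm))
    rw [hν, nuw]
    exact eq_sum_of_monotone hN hsum (fun α => (hzero _).2 ⟨α, rfl⟩) hadj (monotone_sortedVec u)
end

section
/- Let X ⊆ ℝⁿ be nonempty and compact, let U : ℝⁿ → ℝ^N and f : ℝ^N → ℝ be continuous, let γ > 0, and let W₁, W₂ be nonempty compact subsets of ℝ^N with ν_k(u) = sup_{w ∈ W_k} ν_w(u). Define υ_k = min_{x ∈ X} [ f(U(x)) + γ·ν_k(U(x)) ] for k ∈ {1,2} and U_max = max_{x ∈ X} ‖U(x)‖₂ (finite by compactness). Then |υ₁ − υ₂| ≤ γ · U_max · d_H(W₁, W₂). -/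
/-- The nondecreasing rearrangement of `u ∈ ℝ^N` (with the Euclidean structure):
`sortedVecE u i` is the `i`-th smallest entry. -/
noncomputable def sortedVecE {N : ℕ} (u : EuclideanSpace ℝ (Fin N)) : Fin N → ℝ :=
  (fun i => u i) ∘ Tuple.sort (fun i => u i)

/-- The order-based functional `ν_w(u) = Σ_i w_i u_(i)`. -/
noncomputable def nuwE {N : ℕ} (w u : EuclideanSpace ℝ (Fin N)) : ℝ :=
  ∑ i, w i * sortedVecE u i

/-- The nondecreasing rearrangement preserves the Euclidean norm. -/
theorem norm_toLp_sortedVecE {N : ℕ} (u : EuclideanSpace ℝ (Fin N)) :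
    ‖WithLp.toLp 2 (sortedVecE u)‖ = ‖u‖ := by
  rw [EuclideanSpace.norm_eq, EuclideanSpace.norm_eq]
  congr 1
  exact Equiv.sum_comp (Tuple.sort fun i => u i) fun i => ‖u i‖ ^ 2

theorem nuwE_eq_inner {N : ℕ} (w u : EuclideanSpace ℝ (Fin N)) :
    nuwE w u = inner ℝ w (WithLp.toLp 2 (sortedVecE u)) := by
  simp [nuwE, PiLp.inner_apply, mul_comm]

theorem abs_nuwE_le {N : ℕ} (w u : EuclideanSpace ℝ (Fin N)) : |nuwE w u| ≤ ‖w‖ * ‖u‖ := by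
  rw [nuwE_eq_inner, ← norm_toLp_sortedVecE u]
  exact abs_real_inner_le_norm _ _

theorem nuwE_sub_le {N : ℕ} (w w' u : EuclideanSpace ℝ (Fin N)) :
    nuwE w u - nuwE w' u ≤ dist w w' * ‖u‖ := by
  have h : nuwE w u - nuwE w' u = nuwE (w - w') u := by
    simp only [nuwE_eq_inner, inner_sub_left]
  rw [h, dist_eq_norm]
  exact (le_abs_self _).trans (abs_nuwE_le _ _)

theorem bddAbove_nuwE_image {N : ℕ} {W : Set (EuclideanSpace ℝ (Fin N))}
    (hW : Bornology.IsBounded W) (u : EuclideanSpace ℝ (Fin N)) :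
    BddAbove ((fun w => nuwE w u) '' W) := by
  obtain ⟨C, hC⟩ := hW.exists_norm_le
  refine ⟨C * ‖u‖, ?_⟩
  rintro _ ⟨w, hw, rfl⟩
  exact (le_abs_self _).trans ((abs_nuwE_le w u).trans (by gcongr; exact hC w hw))

theorem sSup_nuwE_le_add_hausdorffDist {N : ℕ} {W₁ W₂ : Set (EuclideanSpace ℝ (Fin N))}
    (h1 : W₁.Nonempty) (h2 : W₂.Nonempty) (hb1 : Bornology.IsBounded W₁) (hc2 : IsCompact W₂)
    (u : EuclideanSpace ℝ (Fin N)) :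
    sSup ((fun w => nuwE w u) '' W₁) ≤
      sSup ((fun w => nuwE w u) '' W₂) + Metric.hausdorffDist W₁ W₂ * ‖u‖ := by
  refine csSup_le (h1.image _) ?_
  rintro _ ⟨w, hw, rfl⟩
  obtain ⟨w', hw', hd⟩ := hc2.exists_infDist_eq_dist h2 w
  have hdist : dist w w' ≤ Metric.hausdorffDist W₁ W₂ := by
    rw [← hd]
    exact Metric.infDist_le_hausdorffDist_of_mem hw
      (Metric.hausdorffEDist_ne_top_of_nonempty_of_bounded h1 h2 hb1 hc2.isBounded)
  have hsup : nuwE w' u ≤ sSup ((fun w => nuwE w u) '' W₂) :=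
    le_csSup (bddAbove_nuwE_image hc2.isBounded u) ⟨w', hw', rfl⟩
  have hmul : dist w w' * ‖u‖ ≤ Metric.hausdorffDist W₁ W₂ * ‖u‖ := by gcongr
  have hsub := nuwE_sub_le w w' u
  show nuwE w u ≤ _
  linarith

/-- One-sided stability of the optimal value under a change of the weight set. -/
theorem sInf_sub_sInf_le_hausdorffDist {α : Type*} [TopologicalSpace α] {N : ℕ} {X : Set α}
    (hX : X.Nonempty) (hXc : IsCompact X)
    {U : α → EuclideanSpace ℝ (Fin N)} (hU : Continuous U)
    {f : EuclideanSpace ℝ (Fin N) → ℝ} (hf : Continuous f) {γ : ℝ} (hγ : 0 ≤ γ)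
    {W₁ W₂ : Set (EuclideanSpace ℝ (Fin N))}
    (h1 : W₁.Nonempty) (h2 : W₂.Nonempty) (hb1 : Bornology.IsBounded W₁) (hc2 : IsCompact W₂) :
    sInf ((fun x => f (U x) + γ * sSup ((fun w => nuwE w (U x)) '' W₁)) '' X) -
        sInf ((fun x => f (U x) + γ * sSup ((fun w => nuwE w (U x)) '' W₂)) '' X) ≤
      γ * sSup ((fun x => ‖U x‖) '' X) * Metric.hausdorffDist W₁ W₂ := by
  have hbU : BddAbove ((fun x => ‖U x‖) '' X) := hXc.bddAbove_image hU.norm.continuousOn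
  have hle : ∀ x ∈ X, ‖U x‖ ≤ sSup ((fun x => ‖U x‖) '' X) :=
    fun x hx => le_csSup hbU ⟨x, hx, rfl⟩
  set M := sSup ((fun x => ‖U x‖) '' X)
  have hbdd : BddBelow
      ((fun x => f (U x) + γ * sSup ((fun w => nuwE w (U x)) '' W₁)) '' X) := by
    obtain ⟨m, hm⟩ := hXc.bddBelow_image (hf.comp hU).continuousOn
    obtain ⟨w, hw⟩ := h1
    refine ⟨m + γ * -(‖w‖ * M), ?_⟩
    rintro _ ⟨x, hx, rfl⟩
    have hfx : m ≤ f (U x) := hm ⟨x, hx, rfl⟩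
    have hsup : nuwE w (U x) ≤ sSup ((fun w => nuwE w (U x)) '' W₁) :=
      le_csSup (bddAbove_nuwE_image hb1 (U x)) ⟨w, hw, rfl⟩
    have hlow := (abs_le.mp (abs_nuwE_le w (U x))).1
    have hM : ‖w‖ * ‖U x‖ ≤ ‖w‖ * M := by gcongr; exact hle x hx
    have hν : -(‖w‖ * M) ≤ sSup ((fun w => nuwE w (U x)) '' W₁) := by linarith
    exact add_le_add hfx (mul_le_mul_of_nonneg_left hν hγ)
  rw [sub_le_comm]
  refine le_csInf (hX.image _) ?_
  rintro _ ⟨x, hx, rfl⟩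
  have hinf := csInf_le hbdd ⟨x, hx, rfl⟩
  have hD : Metric.hausdorffDist W₁ W₂ * ‖U x‖ ≤ Metric.hausdorffDist W₁ W₂ * M :=
    mul_le_mul_of_nonneg_left (hle x hx) Metric.hausdorffDist_nonneg
  have hν := mul_le_mul_of_nonneg_left
    ((sSup_nuwE_le_add_hausdorffDist h1 h2 hb1 hc2 (U x)).trans (add_le_add le_rfl hD)) hγ
  rw [sub_le_iff_le_add]
  refine hinf.trans ?_
  show f (U x) + γ * sSup ((fun w => nuwE w (U x)) '' W₁) ≤
    f (U x) + γ * sSup ((fun w => nuwE w (U x)) '' W₂) + _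
  linarith

/-- Stability of the optimal value: with `υ_k = min_{x ∈ X} [f(U(x)) + γ ν_k(U(x))]`,
`ν_k(u) = sup_{w ∈ W_k} ν_w(u)` and `U_max = max_{x ∈ X} ‖U(x)‖₂`, one has
`|υ₁ − υ₂| ≤ γ · U_max · d_H(W₁, W₂)`. -/
theorem stmt15 {n N : ℕ} (X : Set (EuclideanSpace ℝ (Fin n)))
    (hX : X.Nonempty) (hXc : IsCompact X)
    (U : EuclideanSpace ℝ (Fin n) → EuclideanSpace ℝ (Fin N)) (hU : Continuous U)
    (f : EuclideanSpace ℝ (Fin N) → ℝ) (hf : Continuous f)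
    (γ : ℝ) (hγ : 0 < γ)
    (W₁ W₂ : Set (EuclideanSpace ℝ (Fin N)))
    (h1 : W₁.Nonempty) (h2 : W₂.Nonempty) (hc1 : IsCompact W₁) (hc2 : IsCompact W₂) :
    |sInf ((fun x => f (U x) + γ * sSup ((fun w => nuwE w (U x)) '' W₁)) '' X) -
        sInf ((fun x => f (U x) + γ * sSup ((fun w => nuwE w (U x)) '' W₂)) '' X)| ≤
      γ * sSup ((fun x => ‖U x‖) '' X) * Metric.hausdorffDist W₁ W₂ := by
  rw [abs_sub_le_iff]
  refine ⟨sInf_sub_sInf_le_hausdorffDist hX hXc hU hf hγ.le h1 h2 hc1.isBounded hc2, ?_⟩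
  rw [Metric.hausdorffDist_comm]
  exact sInf_sub_sInf_le_hausdorffDist hX hXc hU hf hγ.le h2 h1 hc2.isBounded hc1
end
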